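/- Let R be a Henselian local ring with maximal ideal 𝔪 and residue field κ = R/𝔪, and let S be a commutative R-algebra that is formally smooth over R and of finite presentation over R. Then the restriction map Hom_{R-alg}(S, R) → Hom_{R-alg}(S, κ) is surjective; that is, every R-algebra homomorphism S → κ lifts to an R-algebra homomorphism S → R. -/

import Mathlib

universe u

open IsLocalRing Polynomial in
/-- A standard étale algebra mapping to the residue field of a Henselian local ring maps to the
ring itself. -/
theorem HenselianLocalRing.exists_lift_of_isStandardEtale
    {R : Type u} {A B : Type*} [CommRing R] [HenselianLocalRing R] [CommRing A] [CommRing B]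
    [Algebra A R] [Algebra A B] [Algebra.IsStandardEtale A B] (f : B →ₐ[A] ResidueField R) :
    ∃ g : B →ₐ[A] R, ∀ b, residue R (g b) = f b := by
  let P : StandardEtalePresentation A B :=
    Algebra.IsStandardEtale.nonempty_standardEtalePresentation.some
  let π : R →ₐ[A] ResidueField R := IsScalarTower.toAlgHom A R (ResidueField R)
  have hx : P.HasMap (f P.x) := P.hasMap.map f
  have hroot := ((HenselianLocalRing.TFAE R).out 0 1).mp ‹_›
  obtain ⟨a, ha, hax⟩ := hroot (P.f.map (algebraMap A R)) (P.monic_f.map _) (f P.x)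
    (by simpa using hx.1)
    (by simpa [derivative_map] using hx.isUnit_derivative_f.ne_zero)
  have haπ : π a = f P.x := hax
  have hmap : P.HasMap a := by
    refine ⟨by simpa [IsRoot, eval_map_algebraMap] using ha, ?_⟩
    refine isUnit_of_map_unit (residue R) _ ?_
    have h := hx.2
    rw [← haπ, aeval_algHom_apply] at h
    exact h
  let g : B →ₐ[A] R := (P.lift a hmap).comp P.equivRing.toAlgHom
  have hg : π.comp g = f := P.hom_ext (by simpa [g] using haπ)
  exact ⟨g, fun b ↦ congr($hg b)⟩

/-- Let `R` be a Henselian local ring with maximal ideal `𝔪` and residue field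
`κ = R/𝔪`, and let `S` be a commutative `R`-algebra that is formally smooth over `R` and of finite
presentation over `R`. Then the restriction map `Hom_{R-alg}(S, R) → Hom_{R-alg}(S, κ)` is
surjective; that is, every `R`-algebra homomorphism `S → κ` lifts to an `R`-algebra homomorphism
`S → R`. -/
theorem henselian_lift_algHom_to_residue_field
    (R S : Type u) [CommRing R] [HenselianLocalRing R]
    [CommRing S] [Algebra R S] [Algebra.FormallySmooth R S] [Algebra.FinitePresentation R S] :
    ∀ f : S →ₐ[R] IsLocalRing.ResidueField R,
      ∃ g : S →ₐ[R] R, ∀ s : S, IsLocalRing.residue R (g s) = f s := by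
  intro f
  have : Algebra.Smooth R S := ⟨‹_›, ‹_›⟩
  have : (RingHom.ker f).IsPrime := RingHom.ker_isPrime f
  have : Algebra.IsSmoothAt R (RingHom.ker f) :=
    Set.eq_univ_iff_forall.mp (Algebra.smoothLocus_eq_univ (R := R) (A := S))
      ⟨RingHom.ker f, this⟩
  obtain ⟨s, hs, n, _, _, _⟩ :=
    Algebra.IsSmoothAt.exists_isStandardEtale_mvPolynomial (R := R) (p := RingHom.ker f)
  let F : Localization.Away s →ₐ[R] IsLocalRing.ResidueField R :=
    IsLocalization.liftAlgHom (M := .powers s) (f := f) (by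
      rintro ⟨_, m, rfl⟩
      simpa using IsUnit.pow m (IsUnit.mk0 _ hs))
  choose x hx using fun i : Fin n ↦
    IsLocalRing.residue_surjective (F (algebraMap (MvPolynomial (Fin n) R) _ (.X i)))
  let : Algebra (MvPolynomial (Fin n) R) R := (MvPolynomial.aeval x).toAlgebra
  have : IsScalarTower R (MvPolynomial (Fin n) R) R :=
    .of_algebraMap_eq' (MvPolynomial.aeval (R := R) x).comp_algebraMap.symm
  have hF : (IsScalarTower.toAlgHom R R (IsLocalRing.ResidueField R)).comp (MvPolynomial.aeval x) =
      F.comp (IsScalarTower.toAlgHom R (MvPolynomial (Fin n) R) (Localization.Away s)) :=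
    MvPolynomial.algHom_ext fun i ↦ by simpa using hx i
  let F' : Localization.Away s →ₐ[MvPolynomial (Fin n) R] IsLocalRing.ResidueField R :=
    { F.toRingHom with commutes' := fun p ↦ congr($hF p).symm }
  obtain ⟨g, hg⟩ := HenselianLocalRing.exists_lift_of_isStandardEtale F'
  refine ⟨(g.restrictScalars R).comp (IsScalarTower.toAlgHom R S (Localization.Away s)),
    fun t ↦ (hg _).trans ?_⟩
  exact IsLocalization.lift_eq _ t
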